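/- Let Γ be a nonempty set and 𝕂 ∈ {ℝ, ℂ}. The Banach space ℓ₁(Γ, 𝕂) has the Bishop-Phelps-Bollobás property for numerical radius: for every 0 < ε < 1 there exists δ > 0 such that whenever T is a bounded linear operator on ℓ₁(Γ, 𝕂) with ν(T) = 1 and (x, φ) ∈ Π(ℓ₁(Γ, 𝕂)) satisfies |φ(Tx)| ≥ 1 − δ, there exist a bounded linear operator S on ℓ₁(Γ, 𝕂) with ν(S) = 1 and (y, ψ) ∈ Π(ℓ₁(Γ, 𝕂)) such that ν(T − S) ≤ ε, ‖x − y‖ ≤ ε, ‖φ − ψ‖ ≤ ε, and |ψ(Sy)| = 1. -/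

import Mathlib

open scoped ENNReal

/-- The numerical radius of a bounded linear operator on `ℓ₁(Γ, 𝕂)`:
`ν(T) = sup {|φ(Tx)| : (x, φ) ∈ Π(ℓ₁(Γ, 𝕂))}`, the dual of `ℓ₁(Γ, 𝕂)` being
identified with `ℓ∞(Γ, 𝕂)` acting by `φ(x) = ∑_{γ ∈ Γ} φ(γ) x(γ)`. -/
noncomputable def l1GammaNumRadius (Γ : Type*) (𝕂 : Type*) [RCLike 𝕂]
    (T : lp (fun _ : Γ => 𝕂) 1 →L[𝕂] lp (fun _ : Γ => 𝕂) 1) : ℝ :=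
  sSup {r : ℝ | ∃ (x : lp (fun _ : Γ => 𝕂) 1) (φ : lp (fun _ : Γ => 𝕂) ∞),
    ‖x‖ = 1 ∧ ‖φ‖ = 1 ∧ (∑' γ : Γ, φ γ * x γ) = 1 ∧
    r = ‖∑' γ : Γ, φ γ * (T x) γ‖}

section Lone

variable {Γ 𝕂 E : Type*} [RCLike 𝕂] [NormedAddCommGroup E] [NormedSpace 𝕂 E]

theorem l1_summable_norm (x : lp (fun _ : Γ => 𝕂) 1) : Summable fun γ => ‖x γ‖ := by
  simpa using x.2.summable

theorem l1_norm_eq (x : lp (fun _ : Γ => 𝕂) 1) : ‖x‖ = ∑' γ, ‖x γ‖ := by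
  rw [lp.norm_eq_tsum_rpow (by simp)]; simp

theorem l1_memLp {f : Γ → 𝕂} (hf : Summable fun γ => ‖f γ‖) :
    Memℓp f 1 := memℓp_gen (by simpa using hf)

/-- The operator on `ℓ₁(Γ)` sending the unit vector at `γ` to `w γ`. -/
noncomputable def l1Lift [CompleteSpace E] (w : Γ → E) (C : ℝ) (hw : ∀ γ, ‖w γ‖ ≤ C) :
    lp (fun _ : Γ => 𝕂) 1 →L[𝕂] E :=
  have hle : ∀ (x : lp (fun _ : Γ => 𝕂) 1) γ, ‖x γ • w γ‖ ≤ ‖x γ‖ * C := fun x γ => by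
    rw [norm_smul]; gcongr; exact hw γ
  have hs : ∀ x : lp (fun _ : Γ => 𝕂) 1, Summable fun γ => x γ • w γ := fun x =>
    .of_norm_bounded ((l1_summable_norm x).mul_right C) (hle x)
  LinearMap.mkContinuous
    { toFun := fun x => ∑' γ, x γ • w γ
      map_add' := fun x y => by
        rw [← (hs x).tsum_add (hs y)]
        simp [add_smul]
      map_smul' := fun c x => by
        simp [mul_smul, (hs x).tsum_const_smul] }
    C fun x => by
      refine (tsum_of_norm_bounded ((l1_summable_norm x).mul_right C).hasSum (hle x)).trans_eq ?_
      rw [tsum_mul_right, l1_norm_eq, mul_comm]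

theorem l1Lift_apply [CompleteSpace E] (w : Γ → E) (C : ℝ) (hw : ∀ γ, ‖w γ‖ ≤ C)
    (x : lp (fun _ : Γ => 𝕂) 1) : l1Lift w C hw x = ∑' γ, x γ • w γ := rfl

theorem l1Lift_single [CompleteSpace E] [DecidableEq Γ] (w : Γ → E) (C : ℝ) (hw : ∀ γ, ‖w γ‖ ≤ C)
    (γ : Γ) : l1Lift w C hw (lp.single 1 γ (1 : 𝕂)) = w γ := by
  rw [l1Lift_apply, tsum_eq_single γ]
  · simp
  · intro b hb
    simp [hb]

theorem l1_hasSum_apply [DecidableEq Γ] (T : lp (fun _ : Γ => 𝕂) 1 →L[𝕂] E)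
    (x : lp (fun _ : Γ => 𝕂) 1) :
    HasSum (fun γ => x γ • T (lp.single 1 γ (1 : 𝕂))) (T x) := by
  have h := (lp.hasSum_single ENNReal.one_ne_top x).map T T.continuous
  convert h using 2 with γ
  simp only [Function.comp]
  rw [← map_smul, ← lp.single_smul]
  simp

theorem l1_norm_apply_le [DecidableEq Γ] (T : lp (fun _ : Γ => 𝕂) 1 →L[𝕂] E) {C : ℝ}
    (hT : ∀ γ, ‖T (lp.single 1 γ (1 : 𝕂))‖ ≤ C) (x : lp (fun _ : Γ => 𝕂) 1) :
    ‖T x‖ ≤ C * ‖x‖ := by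
  rw [← (l1_hasSum_apply T x).tsum_eq, l1_norm_eq, ← tsum_mul_left]
  refine tsum_of_norm_bounded ((l1_summable_norm x).mul_left C).hasSum fun γ => ?_
  rw [norm_smul, mul_comm]
  gcongr
  exact hT γ

/-- The functional on `ℓ₁(Γ)` given by an element of `ℓ∞(Γ)`. -/
noncomputable def l1Pairing (φ : lp (fun _ : Γ => 𝕂) ∞) : lp (fun _ : Γ => 𝕂) 1 →L[𝕂] 𝕂 :=
  l1Lift φ ‖φ‖ fun γ => lp.norm_apply_le_norm ENNReal.top_ne_zero φ γ

theorem l1Pairing_apply (φ : lp (fun _ : Γ => 𝕂) ∞) (x : lp (fun _ : Γ => 𝕂) 1) :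
    l1Pairing φ x = ∑' γ, φ γ * x γ := by
  simp [l1Pairing, l1Lift_apply, mul_comm]

theorem l1Pairing_single [DecidableEq Γ] (φ : lp (fun _ : Γ => 𝕂) ∞) (γ : Γ) :
    l1Pairing φ (lp.single 1 γ (1 : 𝕂)) = φ γ := l1Lift_single _ _ _ γ

theorem norm_l1Pairing_le (φ : lp (fun _ : Γ => 𝕂) ∞) (x : lp (fun _ : Γ => 𝕂) 1) :
    ‖l1Pairing φ x‖ ≤ ‖φ‖ * ‖x‖ := by
  classical
  refine l1_norm_apply_le _ (fun γ => ?_) x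
  rw [l1Pairing_single]
  exact lp.norm_apply_le_norm ENNReal.top_ne_zero φ γ

theorem l1_exists_linf [Nonempty Γ] (f : Γ → 𝕂) {C : ℝ} (hf : ∀ γ, ‖f γ‖ ≤ C) :
    ∃ φ : lp (fun _ : Γ => 𝕂) ∞, (∀ γ, φ γ = f γ) ∧ ‖φ‖ ≤ C :=
  ⟨⟨f, memℓp_infty ⟨C, by rintro _ ⟨γ, rfl⟩; exact hf γ⟩⟩, fun _ => rfl,
    lp.norm_le_of_forall_le' C hf⟩

theorem l1GammaNumRadius_le (T : lp (fun _ : Γ => 𝕂) 1 →L[𝕂] lp (fun _ : Γ => 𝕂) 1) {C : ℝ}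
    (hC : 0 ≤ C) (hT : ∀ x, ‖T x‖ ≤ C * ‖x‖) : l1GammaNumRadius Γ 𝕂 T ≤ C := by
  refine Real.sSup_le ?_ hC
  rintro r ⟨x, φ, hx, hφ, -, rfl⟩
  rw [← l1Pairing_apply]
  exact (norm_l1Pairing_le φ _).trans (by simpa [hφ, hx] using hT x)

theorem le_l1GammaNumRadius (T : lp (fun _ : Γ => 𝕂) 1 →L[𝕂] lp (fun _ : Γ => 𝕂) 1)
    {x : lp (fun _ : Γ => 𝕂) 1} {φ : lp (fun _ : Γ => 𝕂) ∞} (hx : ‖x‖ = 1) (hφ : ‖φ‖ = 1)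
    (hφx : (∑' γ, φ γ * x γ) = 1) :
    ‖∑' γ, φ γ * (T x) γ‖ ≤ l1GammaNumRadius Γ 𝕂 T := by
  refine le_csSup ⟨‖T‖, ?_⟩ ⟨x, φ, hx, hφ, hφx, rfl⟩
  rintro r ⟨x, φ, hx, hφ, -, rfl⟩
  rw [← l1Pairing_apply]
  exact (norm_l1Pairing_le φ _).trans (by simpa [hφ, hx] using T.le_opNorm x)

theorem exists_unimodular_mul_eq_norm (z : 𝕂) : ∃ c : 𝕂, ‖c‖ = 1 ∧ c * z = (‖z‖ : 𝕂) := by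
  rcases eq_or_ne z 0 with rfl | hz
  · exact ⟨1, by simp⟩
  · have hz' : (‖z‖ : 𝕂) ≠ 0 := by simpa using hz
    refine ⟨(starRingEnd 𝕂) z / ‖z‖, ?_, ?_⟩
    · simp [norm_div, hz]
    · rw [div_mul_eq_mul_div, RCLike.conj_mul]
      field_simp

theorem norm_single_le_l1GammaNumRadius [DecidableEq Γ]
    (T : lp (fun _ : Γ => 𝕂) 1 →L[𝕂] lp (fun _ : Γ => 𝕂) 1) (γ : Γ) :
    ‖T (lp.single 1 γ (1 : 𝕂))‖ ≤ l1GammaNumRadius Γ 𝕂 T := by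
  have : Nonempty Γ := ⟨γ⟩
  set v := T (lp.single 1 γ (1 : 𝕂)) with hv
  choose c hc hcv using fun β => exists_unimodular_mul_eq_norm (v β)
  have hn : ‖(starRingEnd 𝕂) (c γ)‖ = 1 := by simp [hc]
  obtain ⟨φ, hφ, hφn⟩ := l1_exists_linf (C := 1) (fun β => (starRingEnd 𝕂) (c γ) * c β)
    fun β => by simp [hc]
  have hγ : φ γ = 1 := by rw [hφ, RCLike.conj_mul, hc]; simp
  have h1 : ‖φ‖ = 1 := le_antisymm hφn (by
    simpa [hγ] using lp.norm_apply_le_norm ENNReal.top_ne_zero φ γ)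
  have h2 := le_l1GammaNumRadius T (x := lp.single 1 γ (1 : 𝕂)) (φ := φ)
    (by rw [lp.norm_single (by simp)]; simp) h1
    (by rw [← l1Pairing_apply, l1Pairing_single, hγ])
  refine le_trans (le_of_eq ?_) h2
  simp only [hφ, mul_assoc]
  rw [tsum_mul_left, norm_mul, hn, one_mul]
  simp only [← hv, hcv]
  rw [l1_norm_eq, ← RCLike.ofReal_tsum, RCLike.norm_ofReal, abs_of_nonneg]
  exact tsum_nonneg fun _ => norm_nonneg _

/-- Rounding an element of the unit ball of `ℓ∞(Γ)` to the unit circle at those coordinates where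
its modulus is at least `1 - r`. -/
theorem exists_unimodular_rounding [Nonempty Γ] (φ : lp (fun _ : Γ => 𝕂) ∞) (hφ : ‖φ‖ ≤ 1) {r : ℝ}
    (hr : 0 ≤ r) (hr1 : r < 1) :
    ∃ ψ : lp (fun _ : Γ => 𝕂) ∞, ‖ψ‖ ≤ 1 ∧ ‖φ - ψ‖ ≤ r ∧ (∀ β, ‖φ β‖ = 1 → ψ β = φ β) ∧
      ∀ β, 1 - r ≤ ‖φ β‖ → ‖ψ β‖ = 1 ∧ φ β = (‖φ β‖ : 𝕂) * ψ β := by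
  classical
  have hφ1 : ∀ β, ‖φ β‖ ≤ 1 := fun β =>
    (lp.norm_apply_le_norm ENNReal.top_ne_zero φ β).trans hφ
  set f : Γ → 𝕂 := fun β => if 1 - r ≤ ‖φ β‖ then φ β / (‖φ β‖ : 𝕂) else φ β with hf
  have hbig : ∀ β, 1 - r ≤ ‖φ β‖ → ‖f β‖ = 1 ∧ φ β = (‖φ β‖ : 𝕂) * f β := fun β hβ => by
    have h0 : φ β ≠ 0 := fun h => by rw [h, norm_zero] at hβ; linarith
    have h0' : (‖φ β‖ : 𝕂) ≠ 0 := by simpa using h0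
    simp only [hf, if_pos hβ]
    exact ⟨by simp [norm_div, h0], by field_simp⟩
  have hsmall : ∀ β, ¬ 1 - r ≤ ‖φ β‖ → f β = φ β := fun β hβ => by simp only [hf, if_neg hβ]
  obtain ⟨ψ, hψ, hψ1⟩ := l1_exists_linf (C := 1) f fun β => by
    by_cases hβ : 1 - r ≤ ‖φ β‖
    · exact (hbig β hβ).1.le
    · rw [hsmall β hβ]; exact hφ1 β
  refine ⟨ψ, hψ1, lp.norm_le_of_forall_le hr fun β => ?_, fun β hβ => ?_, fun β hβ => ?_⟩
  · rw [lp.coeFn_sub, Pi.sub_apply, hψ]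
    by_cases hβ : 1 - r ≤ ‖φ β‖
    · obtain ⟨h1, h2⟩ := hbig β hβ
      have h3 : φ β - f β = ((‖φ β‖ - 1 : ℝ) : 𝕂) * f β := by
        rw [RCLike.ofReal_sub, sub_mul, ← h2]; simp
      rw [h3, norm_mul, h1, RCLike.norm_ofReal, abs_of_nonpos (by linarith [hφ1 β])]
      linarith
    · simpa [hsmall β hβ] using hr
  · rw [hψ]; simp [hf, hβ]
  · rw [hψ]; exact hbig β hβ

theorem norm_sub_norm_le_re (z : 𝕂) {t : ℝ} (ht : 0 < t) :
    ‖z - (‖z‖ : 𝕂)‖ ≤ t * ‖z‖ + (‖z‖ - RCLike.re z) / t := by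
  have hre := RCLike.re_le_norm z
  have hd : 0 ≤ (‖z‖ - RCLike.re z) / t := div_nonneg (by linarith) ht.le
  have hz := norm_nonneg z
  refine abs_le_of_sq_le_sq' ?_ (by positivity) |>.2
  have h1 : ‖z - (‖z‖ : 𝕂)‖ ^ 2 = 2 * ‖z‖ * (‖z‖ - RCLike.re z) := by
    rw [← RCLike.normSq_eq_def', RCLike.normSq_apply]
    have := RCLike.normSq_eq_def' z
    rw [RCLike.normSq_apply] at this
    simp only [map_sub, RCLike.ofReal_re, RCLike.ofReal_im]
    linear_combination this
  have h2 : ‖z‖ - RCLike.re z = t * ((‖z‖ - RCLike.re z) / t) := by field_simp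
  rw [h1]
  set e := (‖z‖ - RCLike.re z) / t
  rw [h2]
  nlinarith [sq_nonneg (t * ‖z‖ - e), mul_nonneg (mul_nonneg ht.le hz) hd, sq_nonneg (t * ‖z‖),
    sq_nonneg e]

theorem norm_sub_conj_mul_norm_le {k t : ℝ} (hk0 : 0 ≤ k) (hk : k ≤ 1) (ht : 0 < t) {b : 𝕂}
    (hb : ‖b‖ = 1) (v : 𝕂) :
    ‖v - (starRingEnd 𝕂) b * (‖v‖ : 𝕂)‖ ≤
      t * ‖v‖ + 2 / t * (‖v‖ - RCLike.re ((k : 𝕂) * b * v)) := by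
  have hbb : b * (starRingEnd 𝕂) b = 1 := by rw [RCLike.mul_conj, hb]; simp
  have hn : ‖b * v‖ = ‖v‖ := by rw [norm_mul, hb, one_mul]
  have h1 : ‖v - (starRingEnd 𝕂) b * (‖v‖ : 𝕂)‖ = ‖b * v - (‖b * v‖ : 𝕂)‖ := by
    rw [hn, ← one_mul ‖v - _‖, ← hb, ← norm_mul, mul_sub, ← mul_assoc, hbb, one_mul]
  rw [h1]
  refine (norm_sub_norm_le_re _ ht).trans ?_
  rw [mul_assoc, RCLike.re_ofReal_mul, hn, div_eq_inv_mul, div_eq_inv_mul, mul_assoc t⁻¹]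
  have h2 := (abs_le.1 (RCLike.abs_re_le_norm (b * v)))
  rw [hn] at h2
  gcongr
  nlinarith [h2.1, h2.2]

/-- If `φ` nearly attains its norm at `v`, then `v` can be moved slightly so that the rounding `ψ`
of `φ` attains its norm there. -/
theorem exists_near_attaining (φ ψ : lp (fun _ : Γ => 𝕂) ∞) (hφ : ‖φ‖ ≤ 1) {r t η : ℝ}
    (hr : 0 < r) (ht : 0 < t)
    (hψ : ∀ β, 1 - r ≤ ‖φ β‖ → ‖ψ β‖ = 1 ∧ φ β = (‖φ β‖ : 𝕂) * ψ β) {α : Γ} (hα : ‖ψ α‖ = 1)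
    (v : lp (fun _ : Γ => 𝕂) 1) (hv : ‖v‖ ≤ 1) (hφv : 1 - η ≤ RCLike.re (l1Pairing φ v)) :
    ∃ w : lp (fun _ : Γ => 𝕂) 1, ‖w‖ ≤ 1 ∧ l1Pairing ψ w = 1 ∧
      ‖v - w‖ ≤ t + 2 / t * η + 2 / r * η + η := by
  classical
  have hφ1 : ∀ β, ‖φ β‖ ≤ 1 := fun β =>
    (lp.norm_apply_le_norm ENNReal.top_ne_zero φ β).trans hφ
  have hsv := l1_summable_norm v
  have hsφ : Summable fun β => φ β * v β :=
    .of_norm_bounded hsv fun β => by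
      rw [norm_mul]; exact mul_le_of_le_one_left (norm_nonneg _) (hφ1 β)
  have hre : HasSum (fun β => RCLike.re (φ β * v β)) (RCLike.re (l1Pairing φ v)) := by
    rw [l1Pairing_apply]
    exact RCLike.hasSum_re 𝕂 hsφ.hasSum
  set d : Γ → ℝ := fun β => ‖v β‖ - RCLike.re (φ β * v β) with hd
  have hd0 : ∀ β, 0 ≤ d β := fun β => by
    have := RCLike.re_le_norm (φ β * v β)
    rw [norm_mul] at this
    have := mul_le_of_le_one_left (norm_nonneg (v β)) (hφ1 β)
    simp only [hd]; linarith
  have hvs : HasSum (fun β => ‖v β‖) ‖v‖ := l1_norm_eq v ▸ hsv.hasSum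
  have hds : HasSum d (‖v‖ - RCLike.re (l1Pairing φ v)) := hvs.sub hre
  set D := ‖v‖ - RCLike.re (l1Pairing φ v) with hD
  have hDη : D ≤ η := by linarith
  have hD0 : 0 ≤ D := hds.nonneg hd0
  set B : Set Γ := {β | 1 - r ≤ ‖φ β‖} with hB
  set f : Γ → ℝ := B.indicator fun β => ‖v β‖ with hf
  have hf0 : ∀ β, 0 ≤ f β := Set.indicator_nonneg fun β _ => norm_nonneg _
  have hfv : ∀ β, f β ≤ ‖v β‖ := Set.indicator_le_self' fun β _ => norm_nonneg _
  have hfs : Summable f := .of_nonneg_of_le hf0 hfv hsv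
  have hout : ∀ β, β ∉ B → ‖v β‖ ≤ 1 / r * d β := fun β hβ => by
    have hβ' : ‖φ β‖ < 1 - r := not_le.1 hβ
    have h1 := RCLike.re_le_norm (φ β * v β)
    rw [norm_mul] at h1
    have h2 := norm_nonneg (v β)
    rw [div_mul_eq_mul_div, one_mul, le_div_iff₀ hr]
    simp only [hd]
    nlinarith
  set s := ∑' β, f β with hs
  have hs1 : s ≤ ‖v‖ := by rw [l1_norm_eq]; exact hfs.tsum_le_tsum hfv hsv
  have hs2 : ‖v‖ - s ≤ 1 / r * D := by
    refine hasSum_le (fun β => ?_) (hvs.sub hfs.hasSum) (hds.mul_left (1 / r))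
    by_cases hβ : β ∈ B
    · simp only [hf, Set.indicator_of_mem hβ, sub_self]
      exact mul_nonneg (by positivity) (hd0 β)
    · simp only [hf, Set.indicator_of_notMem hβ, sub_zero]
      exact hout β hβ
  have hg : ∀ β, ‖(starRingEnd 𝕂) (ψ β) * (f β : 𝕂)‖ = f β := fun β => by
    by_cases hβ : β ∈ B
    · rw [norm_mul, RCLike.norm_conj, (hψ β hβ).1, one_mul, RCLike.norm_ofReal,
        abs_of_nonneg (hf0 β)]
    · simp [hf, hβ]
  let u : lp (fun _ : Γ => 𝕂) 1 :=
    ⟨fun β => (starRingEnd 𝕂) (ψ β) * (f β : 𝕂), l1_memLp (by simpa only [hg] using hfs)⟩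
  have hu : ∀ β, u β = (starRingEnd 𝕂) (ψ β) * (f β : 𝕂) := fun β => rfl
  have hun : ‖u‖ = s := by rw [l1_norm_eq]; simp only [hu, hg, hs]
  have hψu : l1Pairing ψ u = (s : 𝕂) := by
    rw [l1Pairing_apply, hs, RCLike.ofReal_tsum]
    refine tsum_congr fun β => ?_
    by_cases hβ : β ∈ B
    · rw [hu, ← mul_assoc, RCLike.mul_conj, (hψ β hβ).1]; simp
    · simp [hu, hf, hβ]
  have hvu : ‖v - u‖ ≤ t * ‖v‖ + 2 / t * D + 1 / r * D := by
    rw [l1_norm_eq]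
    refine hasSum_le (fun β => ?_) (l1_summable_norm (v - u)).hasSum
      (((hvs.mul_left t).add (hds.mul_left (2 / t))).add (hds.mul_left (1 / r)))
    have h1 : 0 ≤ 1 / r * d β := mul_nonneg (by positivity) (hd0 β)
    have h2 : 0 ≤ 2 / t * d β := mul_nonneg (by positivity) (hd0 β)
    have h3 : 0 ≤ t * ‖v β‖ := by positivity
    rw [lp.coeFn_sub, Pi.sub_apply, hu]
    by_cases hβ : β ∈ B
    · have h4 := norm_sub_conj_mul_norm_le (norm_nonneg (φ β)) (hφ1 β) ht (hψ β hβ).1 (v β)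
      rw [← (hψ β hβ).2] at h4
      simp only [hf, Set.indicator_of_mem hβ]
      change _ ≤ t * ‖v β‖ + 2 / t * d β at h4
      linarith
    · have := hout β hβ
      simp only [hf, Set.indicator_of_notMem hβ, RCLike.ofReal_zero, mul_zero, sub_zero]
      linarith
  set e : lp (fun _ : Γ => 𝕂) 1 :=
    (((1 - s : ℝ) : 𝕂) * (starRingEnd 𝕂) (ψ α)) • lp.single 1 α (1 : 𝕂) with he
  have hen : ‖e‖ = 1 - s := by
    rw [he, norm_smul, lp.norm_single (by simp), norm_mul, RCLike.norm_conj, hα,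
      RCLike.norm_ofReal, abs_of_nonneg (by linarith)]
    simp
  refine ⟨u + e, ?_, ?_, ?_⟩
  · refine (norm_add_le _ _).trans_eq ?_
    rw [hun, hen]; ring
  · rw [map_add, hψu, he, map_smul, l1Pairing_single, smul_eq_mul, mul_assoc, RCLike.conj_mul, hα]
    simp
  · have h1 : ‖v - (u + e)‖ ≤ ‖v - u‖ + ‖e‖ := by
      rw [← sub_sub]; exact norm_sub_le _ _
    have h2 : t * ‖v‖ ≤ t := mul_le_of_le_one_right ht.le hv
    have h3 : 2 / t * D ≤ 2 / t * η := by gcongr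
    have h4 : 2 / r * D ≤ 2 / r * η := by gcongr
    have h5 : 2 / r * D = 1 / r * D + 1 / r * D := by ring
    have h6 : RCLike.re (l1Pairing φ v) ≤ ‖v‖ :=
      (RCLike.re_le_norm _).trans ((norm_l1Pairing_le φ v).trans
        (mul_le_of_le_one_left (norm_nonneg _) hφ))
    linarith

theorem exists_normalized_truncation (x : lp (fun _ : Γ => 𝕂) 1) (hx : ‖x‖ = 1) {q : Γ → ℝ}
    (hq : ∀ γ, q γ ≤ 1) {Q η ε : ℝ} (hη : 0 < η) (hε : ε < 1)
    (hQ : HasSum (fun γ => ‖x γ‖ * q γ) Q) (hQε : 1 - η * (ε / 2) ≤ Q) :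
    ∃ (y : lp (fun _ : Γ => 𝕂) 1) (k : ℝ), 0 ≤ k ∧ ‖y‖ = 1 ∧ ‖x - y‖ ≤ ε ∧
      (∀ γ, y γ = (k : 𝕂) * x γ ∨ y γ = 0) ∧
      ∀ γ, y γ ≠ 0 → x γ ≠ 0 ∧ 1 - η ≤ q γ := by
  classical
  set A : Set Γ := {γ | 1 - η ≤ q γ} with hA
  have hsx := l1_summable_norm x
  have hxs : HasSum (fun γ => ‖x γ‖) 1 := by
    have h := hsx.hasSum
    rwa [← l1_norm_eq, hx] at h
  have hle : ∀ γ, ‖A.indicator x γ‖ ≤ ‖x γ‖ := fun γ => norm_indicator_le_norm_self _ _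
  have hs := Summable.of_nonneg_of_le (fun γ => norm_nonneg _) hle hsx
  let z : lp (fun _ : Γ => 𝕂) 1 := ⟨A.indicator x, l1_memLp hs⟩
  have hz : ∀ γ, z γ = A.indicator x γ := fun γ => rfl
  have hzs : HasSum (fun γ => ‖z γ‖) ‖z‖ := l1_norm_eq z ▸ (l1_summable_norm z).hasSum
  have hxz : ‖x - z‖ = 1 - ‖z‖ := by
    rw [l1_norm_eq]
    rw [← (hxs.sub hzs).tsum_eq]
    refine tsum_congr fun γ => ?_
    rw [lp.coeFn_sub, Pi.sub_apply, hz]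
    by_cases hγ : γ ∈ A <;> simp [hγ]
  have hz1 : 1 - ‖z‖ ≤ ε / 2 := by
    have h : η * (1 - ‖z‖) ≤ 1 - Q := by
      refine hasSum_le (fun γ => ?_) ((hxs.sub hzs).mul_left η) (hxs.sub hQ)
      rw [hz]
      have h0 := norm_nonneg (x γ)
      by_cases hγ : γ ∈ A
      · simp only [Set.indicator_of_mem hγ, sub_self, mul_zero]
        nlinarith [hq γ]
      · have hγ' : q γ < 1 - η := not_le.1 hγ
        simp only [Set.indicator_of_notMem hγ, norm_zero, sub_zero]
        nlinarith
    exact le_of_mul_le_mul_left (by linarith) hη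
  have hz0 : 0 < ‖z‖ := by linarith
  have hz2 : ‖z‖ ≤ 1 := by have := norm_nonneg (x - z); linarith
  have hy : ∀ γ, ((‖z‖⁻¹ : ℝ) : 𝕂) • z γ = ((‖z‖⁻¹ : ℝ) : 𝕂) * z γ := fun γ => rfl
  refine ⟨((‖z‖⁻¹ : ℝ) : 𝕂) • z, ‖z‖⁻¹, by positivity, ?_, ?_, fun γ => ?_, fun γ hγ => ?_⟩
  · rw [norm_smul, RCLike.norm_ofReal, abs_of_nonneg (by positivity), inv_mul_cancel₀ hz0.ne']
  · have h1 : z - ((‖z‖⁻¹ : ℝ) : 𝕂) • z = ((1 - ‖z‖⁻¹ : ℝ) : 𝕂) • z := by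
      rw [RCLike.ofReal_sub, sub_smul]; simp
    have h2 : ‖z - ((‖z‖⁻¹ : ℝ) : 𝕂) • z‖ = 1 - ‖z‖ := by
      rw [h1, norm_smul, RCLike.norm_ofReal, abs_of_nonpos]
      · field_simp; ring
      · have := (one_le_inv₀ hz0).2 hz2
        linarith
    have h3 := norm_sub_le_norm_sub_add_norm_sub x z (((‖z‖⁻¹ : ℝ) : 𝕂) • z)
    linarith
  · rw [lp.coeFn_smul, Pi.smul_apply, smul_eq_mul, hz]
    by_cases hγ : γ ∈ A <;> simp [hγ]
  · rw [lp.coeFn_smul, Pi.smul_apply, smul_eq_mul, hz] at hγ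
    by_cases hγA : γ ∈ A
    · refine ⟨fun h => hγ ?_, hγA⟩
      simp [h, hγA]
    · simp [hγA] at hγ

theorem mul_eq_norm_of_l1Pairing_eq_one {x : lp (fun _ : Γ => 𝕂) 1} {φ : lp (fun _ : Γ => 𝕂) ∞}
    (hx : ‖x‖ = 1) (hφ : ‖φ‖ ≤ 1) (h : l1Pairing φ x = 1) (γ : Γ) :
    φ γ * x γ = (‖x γ‖ : 𝕂) := by
  have hle : ∀ γ, ‖φ γ * x γ‖ ≤ ‖x γ‖ := fun γ => by
    rw [norm_mul]
    exact mul_le_of_le_one_left (norm_nonneg _)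
      ((lp.norm_apply_le_norm ENNReal.top_ne_zero φ γ).trans hφ)
  have hsx := l1_summable_norm x
  have hre : HasSum (fun β => RCLike.re (φ β * x β)) 1 := by
    have h1 := RCLike.hasSum_re 𝕂 (Summable.of_norm_bounded hsx hle).hasSum
    rwa [← l1Pairing_apply, h, RCLike.one_re] at h1
  have hxs : HasSum (fun γ => ‖x γ‖) 1 := by
    have h := hsx.hasSum
    rwa [← l1_norm_eq, hx] at h
  have h0 : HasSum (fun γ => ‖x γ‖ - RCLike.re (φ γ * x γ)) 0 := by simpa using hxs.sub hre
  have h1 := (hasSum_zero_iff_of_nonneg fun γ => sub_nonneg.2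
    ((RCLike.re_le_norm _).trans (hle γ))).1 h0
  have h2 : ‖x γ‖ = RCLike.re (φ γ * x γ) := sub_eq_zero.1 (congrFun h1 γ)
  have h3 := RCLike.norm_le_re_iff_eq_norm.1 ((hle γ).trans_eq h2)
  have h4 : ‖φ γ * x γ‖ = ‖x γ‖ :=
    le_antisymm (hle γ) (h2.le.trans (RCLike.re_le_norm _))
  rwa [h4] at h3

end Lone

/-- `ℓ₁(Γ, 𝕂)`, `𝕂 ∈ {ℝ, ℂ}`, has the Bishop–Phelps–Bollobás property for
numerical radius. -/
theorem bpb_property_numerical_radius_l1_general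
    (Γ : Type*) [Nonempty Γ] (𝕂 : Type*) [RCLike 𝕂] :
    ∀ ε : ℝ, 0 < ε → ε < 1 → ∃ δ : ℝ, 0 < δ ∧
      ∀ (T : lp (fun _ : Γ => 𝕂) 1 →L[𝕂] lp (fun _ : Γ => 𝕂) 1)
        (x : lp (fun _ : Γ => 𝕂) 1) (φ : lp (fun _ : Γ => 𝕂) ∞),
        l1GammaNumRadius Γ 𝕂 T = 1 →
        ‖x‖ = 1 → ‖φ‖ = 1 → (∑' γ : Γ, φ γ * x γ) = 1 →
        1 - δ ≤ ‖∑' γ : Γ, φ γ * (T x) γ‖ →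
        ∃ (S : lp (fun _ : Γ => 𝕂) 1 →L[𝕂] lp (fun _ : Γ => 𝕂) 1)
          (y : lp (fun _ : Γ => 𝕂) 1) (ψ : lp (fun _ : Γ => 𝕂) ∞),
          l1GammaNumRadius Γ 𝕂 S = 1 ∧ ‖y‖ = 1 ∧ ‖ψ‖ = 1 ∧
          (∑' γ : Γ, ψ γ * y γ) = 1 ∧
          l1GammaNumRadius Γ 𝕂 (T - S) ≤ ε ∧ ‖x - y‖ ≤ ε ∧ ‖φ - ψ‖ ≤ ε ∧
          ‖∑' γ : Γ, ψ γ * (S y) γ‖ = 1 := by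
  classical
  intro ε hε hε1
  refine ⟨ε ^ 2 / 64 * (ε / 2), by positivity, fun T x φ hT hx hφ hφx hδ => ?_⟩
  set η := ε ^ 2 / 64 with hη
  have hη0 : 0 < η := by positivity
  rw [← l1Pairing_apply] at hφx hδ
  have hTe : ∀ γ, ‖T (lp.single 1 γ (1 : 𝕂))‖ ≤ 1 := fun γ =>
    hT ▸ norm_single_le_l1GammaNumRadius T γ
  have hφ1 : ∀ γ, ‖φ γ‖ ≤ 1 := fun γ =>
    hφ ▸ lp.norm_apply_le_norm ENNReal.top_ne_zero φ γ
  have hφxγ := mul_eq_norm_of_l1Pairing_eq_one hx hφ.le hφx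
  have hφu : ∀ γ, x γ ≠ 0 → ‖φ γ‖ = 1 := fun γ hγ => by
    have h := congrArg norm (hφxγ γ)
    rw [norm_mul, RCLike.norm_ofReal, abs_norm] at h
    exact mul_right_cancel₀ (norm_ne_zero_iff.2 hγ) (by rw [h, one_mul])
  have hxφ : ∀ γ, x γ = (‖x γ‖ : 𝕂) * (starRingEnd 𝕂) (φ γ) := fun γ => by
    by_cases hγ : x γ = 0
    · simp [hγ]
    · rw [← hφxγ γ, mul_right_comm, RCLike.mul_conj, hφu γ hγ]
      simp
  obtain ⟨ω, hω, hωT⟩ := exists_unimodular_mul_eq_norm (l1Pairing φ (T x))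
  set a : Γ → 𝕂 := fun γ => ω * (starRingEnd 𝕂) (φ γ) with ha
  have ha1 : ∀ γ, ‖a γ‖ ≤ 1 := fun γ => by simpa [ha, hω] using hφ1 γ
  set q : Γ → ℝ := fun γ => RCLike.re (l1Pairing φ (a γ • T (lp.single 1 γ (1 : 𝕂)))) with hq
  have haT : ∀ γ, ‖a γ • T (lp.single 1 γ (1 : 𝕂))‖ ≤ 1 := fun γ => by
    rw [norm_smul]; exact mul_le_one₀ (ha1 γ) (norm_nonneg _) (hTe γ)
  have hq1 : ∀ γ, q γ ≤ 1 := fun γ => by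
    refine (RCLike.re_le_norm _).trans ((norm_l1Pairing_le φ _).trans ?_)
    rw [hφ, one_mul]
    exact haT γ
  have hQ : HasSum (fun γ => ‖x γ‖ * q γ) ‖l1Pairing φ (T x)‖ := by
    have h := RCLike.hasSum_re 𝕂
      ((l1_hasSum_apply ((l1Pairing φ).comp T) x).mul_left ω)
    rw [ContinuousLinearMap.comp_apply, hωT, RCLike.ofReal_re] at h
    convert h using 2 with γ
    simp only [hq, ha, ContinuousLinearMap.comp_apply, map_smul, smul_eq_mul]
    rw [← RCLike.re_ofReal_mul]
    conv_rhs => rw [hxφ γ]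
    congr 1
    ring
  obtain ⟨y, k, hk, hy1, hxy, hyx, hyA⟩ :=
    exists_normalized_truncation x hx hq1 hη0 hε1 hQ hδ
  obtain ⟨ψ, hψ1, hφψ, hψφ, hψ⟩ := exists_unimodular_rounding φ hφ.le hε.le hε1
  have hφy : ∀ γ, φ γ * y γ = (‖y γ‖ : 𝕂) := fun γ => by
    rcases hyx γ with h | h
    · rw [h, mul_left_comm, hφxγ, norm_mul, RCLike.norm_ofReal, abs_of_nonneg hk,
        RCLike.ofReal_mul]
    · simp [h]
  have hψy : ∀ γ, ψ γ * y γ = (‖y γ‖ : 𝕂) := fun γ => by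
    by_cases h : y γ = 0
    · simp [h]
    · rw [hψφ γ (hφu γ (hyA γ h).1), hφy]
  have hψys : (∑' γ, ψ γ * y γ) = 1 := by
    simp only [hψy]
    rw [← RCLike.ofReal_tsum, ← l1_norm_eq, hy1, RCLike.ofReal_one]
  have hψn : ‖ψ‖ = 1 := by
    refine le_antisymm hψ1 ?_
    have h := norm_l1Pairing_le ψ y
    rwa [l1Pairing_apply, hψys, hy1, norm_one, mul_one] at h
  have hw : ∀ γ, ∃ w : lp (fun _ : Γ => 𝕂) 1, ‖w‖ ≤ 1 ∧
      ‖T (lp.single 1 γ (1 : 𝕂)) - w‖ ≤ ε ∧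
      (y γ ≠ 0 → l1Pairing ψ w = (starRingEnd 𝕂) (a γ)) := fun γ => by
    by_cases hγ : y γ = 0
    · exact ⟨_, hTe γ, by simpa using hε.le, fun h => absurd hγ h⟩
    · obtain ⟨hxγ, hqγ⟩ := hyA γ hγ
      have han : ‖a γ‖ = 1 := by simp [ha, hω, hφu γ hxγ]
      have hψγ : ‖ψ γ‖ = 1 := by rw [hψφ γ (hφu γ hxγ), hφu γ hxγ]
      obtain ⟨w, hw1, hψw, hvw⟩ := exists_near_attaining φ ψ hφ.le (t := ε / 4) hε (by positivity)
        hψ hψγ _ (haT γ) hqγ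
      have hbound : ε / 4 + 2 / (ε / 4) * η + 2 / ε * η + η ≤ ε := by
        have h1 : 2 / (ε / 4) * η = ε / 8 := by rw [hη]; field_simp; norm_num
        have h2 : 2 / ε * η = ε / 32 := by rw [hη]; field_simp; norm_num
        rw [h1, h2, hη]
        nlinarith
      refine ⟨(starRingEnd 𝕂) (a γ) • w, ?_, ?_, fun _ => ?_⟩
      · rw [norm_smul, RCLike.norm_conj, han, one_mul]
        exact hw1
      · have h : T (lp.single 1 γ (1 : 𝕂)) - (starRingEnd 𝕂) (a γ) • w =
            (starRingEnd 𝕂) (a γ) • (a γ • T (lp.single 1 γ (1 : 𝕂)) - w) := by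
          rw [smul_sub, smul_smul, RCLike.conj_mul, han]
          simp
        rw [h, norm_smul, RCLike.norm_conj, han, one_mul]
        exact hvw.trans hbound
      · rw [map_smul, hψw, smul_eq_mul, mul_one]
  choose w hw1 hTw hψw using hw
  set S : lp (fun _ : Γ => 𝕂) 1 →L[𝕂] lp (fun _ : Γ => 𝕂) 1 := l1Lift w 1 hw1 with hS
  have hSe : ∀ γ, S (lp.single 1 γ (1 : 𝕂)) = w γ := l1Lift_single w 1 hw1
  have hSy : ‖∑' γ, ψ γ * (S y) γ‖ = 1 := by
    have h : l1Pairing ψ (S y) = (starRingEnd 𝕂) ω := by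
      have h1 := (l1_hasSum_apply ((l1Pairing ψ).comp S) y).tsum_eq
      rw [ContinuousLinearMap.comp_apply] at h1
      have h2 := tsum_mul_left (f := fun γ => ψ γ * y γ) (a := (starRingEnd 𝕂) ω)
        (L := SummationFilter.unconditional Γ)
      rw [hψys, mul_one] at h2
      rw [← h1, ← h2]
      refine tsum_congr fun γ => ?_
      by_cases hγ : y γ = 0
      · simp [hγ]
      · rw [ContinuousLinearMap.comp_apply, hSe, hψw γ hγ, hψφ γ (hφu γ (hyA γ hγ).1)]
        simp only [ha, map_mul, RCLike.conj_conj, smul_eq_mul]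
        ring
    rw [← l1Pairing_apply, h, RCLike.norm_conj, hω]
  refine ⟨S, y, ψ, le_antisymm ?_ ?_, hy1, hψn, hψys, ?_, hxy, hφψ, hSy⟩
  · exact l1GammaNumRadius_le S zero_le_one (l1_norm_apply_le S fun γ => (hSe γ).symm ▸ hw1 γ)
  · exact hSy ▸ le_l1GammaNumRadius S hy1 hψn hψys
  · refine l1GammaNumRadius_le _ hε.le (l1_norm_apply_le _ fun γ => ?_)
    rw [sub_apply, hSe]
    exact hTw γ
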